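/- Let d ≥ 3, n = 3, and let R = k[t₁,t₂,t₃]. Let J ⊆ S̃ ⊗_k R be the ideal generated by all generators of P_{3d} except the three vertices, together with the three deformed vertex generators x_{11}···x_{1d} + t₁·x_{11}···x_{1(d−2)}x_{22}x_{32}, x_{21}···x_{2d} + t₂·x_{21}···x_{2(d−2)}x_{12}x_{32}, and x_{31}···x_{3d} + t₃·x_{31}···x_{3(d−2)}x_{12}x_{22}. Then (S̃ ⊗_k R)/J is flat as an R-module, and setting t₁ = t₂ = t₃ = 0 carries J to P_{3d}. -/

import Mathlib

/-!
Statement 8: For `d ≥ 3` and `n = 3`, the ideal `J ⊆ S̃ ⊗_k R`, `R = k[t₁,t₂,t₃]`,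
generated by all generators of `P_{3d}` except the three vertices together with the three
deformed vertex generators
`x_{11}⋯x_{1d} + t₁ x_{11}⋯x_{1(d−2)}x_{22}x_{32}`,
`x_{21}⋯x_{2d} + t₂ x_{21}⋯x_{2(d−2)}x_{12}x_{32}`,
`x_{31}⋯x_{3d} + t₃ x_{31}⋯x_{3(d−2)}x_{12}x_{22}`,
defines a quotient which is flat over `R`, and setting `t₁ = t₂ = t₃ = 0` carries `J`
to `P_{3d}`.  Here `S̃ ⊗_k R` is realized as `MvPolynomial (Fin 3 × Fin d) R`, and the
second index `j` of `x_{ij}` is 0-based (so `x_{i2}` is `X (i, 1)`).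
-/

set_option synthInstance.maxHeartbeats 800000
set_option maxHeartbeats 1600000

open MvPolynomial

noncomputable section

/-- The standard polarization `P_{nd}` of `m^d`. -/
def StdIdeal (k : Type) [Field k] (n d : ℕ) : Ideal (MvPolynomial (Fin n × Fin d) k) :=
  Ideal.span {f | ∃ e : Fin n → ℕ, (∑ i, e i) = d ∧
    f = ∏ p : Fin n × Fin d, if (p.2 : ℕ) < e p.1 then X p else 1}

/-- The vertex `f_i = x_{i1}x_{i2}⋯x_{id}` (in `S̃ ⊗_k R`). -/
def vert8 (k : Type) [Field k] (d : ℕ) (i : Fin 3) :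
    MvPolynomial (Fin 3 × Fin d) (MvPolynomial (Fin 3) k) :=
  ∏ j : Fin d, X (i, j)

/-- The deforming monomial `m_i = x_{i1}⋯x_{i(d−2)} x_{(i+1)2} x_{(i+2)2}` (indices mod 3). -/
def defm8 (k : Type) [Field k] (d : ℕ) [NeZero d] (i : Fin 3) :
    MvPolynomial (Fin 3 × Fin d) (MvPolynomial (Fin 3) k) :=
  (∏ j : Fin d, if (j : ℕ) < d - 2 then X (i, j) else 1) *
    (X (i + 1, (1 : Fin d)) * X (i + 2, (1 : Fin d)))

/-- The ideal `J`: the non-vertex generators of `P_{3d}` together with the three deformed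
vertex generators `f_i + t_i·m_i`. -/
def J8 (k : Type) [Field k] (d : ℕ) [NeZero d] :
    Ideal (MvPolynomial (Fin 3 × Fin d) (MvPolynomial (Fin 3) k)) :=
  Ideal.span
    ({f | ∃ e : Fin 3 → ℕ, (∑ i, e i) = d ∧ (∀ i, e i ≠ d) ∧
        f = ∏ p : Fin 3 × Fin d, if (p.2 : ℕ) < e p.1 then X p else 1} ∪
      {f | ∃ i : Fin 3, f = vert8 k d i + C (X i) * defm8 k d i})

/-- Setting `t₁ = t₂ = t₃ = 0`: the map `S̃ ⊗_k R → S̃`. -/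
def red8 (k : Type) [Field k] (d : ℕ) :
    MvPolynomial (Fin 3 × Fin d) (MvPolynomial (Fin 3) k) →+* MvPolynomial (Fin 3 × Fin d) k :=
  MvPolynomial.map (MvPolynomial.aeval (fun _ : Fin 3 => (0 : k))).toRingHom

section NormalForm

variable {d : ℕ}

/-- The exponent vector of `∏ᵢ x_{i1}⋯x_{ie_i}`. -/
def initialExp (d : ℕ) (e : Fin 3 → ℕ) : Fin 3 × Fin d →₀ ℕ :=
  Finsupp.equivFunOnFinite.symm fun p => if (p.2 : ℕ) < e p.1 then 1 else 0

/-- The exponent vector of the vertex `f_i`. -/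
def vertExp (d : ℕ) (i : Fin 3) : Fin 3 × Fin d →₀ ℕ := initialExp d (Pi.single i d)

/-- The exponent vector of the deforming monomial `m_i`. -/
def defmExp (d : ℕ) [NeZero d] (i : Fin 3) : Fin 3 × Fin d →₀ ℕ :=
  initialExp d (Pi.single i (d - 2)) +
    (Finsupp.single (i + 1, (1 : Fin d)) 1 + Finsupp.single (i + 2, (1 : Fin d)) 1)

/-- `a` is the exponent vector of a multiple of a non-vertex generator of `P_{3d}`. -/
def NonVertexMultiple (a : Fin 3 × Fin d →₀ ℕ) : Prop :=
  ∃ e : Fin 3 → ℕ, (∑ i, e i) = d ∧ (∀ i, e i ≠ d) ∧ initialExp d e ≤ a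

theorem initialExp_apply (e : Fin 3 → ℕ) (p : Fin 3 × Fin d) :
    initialExp d e p = if (p.2 : ℕ) < e p.1 then 1 else 0 := rfl

theorem monomial_initialExp {R : Type*} [CommSemiring R] (e : Fin 3 → ℕ) :
    (monomial (initialExp d e) 1 : MvPolynomial (Fin 3 × Fin d) R) =
      ∏ p : Fin 3 × Fin d, if (p.2 : ℕ) < e p.1 then X p else 1 := by
  rw [monomial_eq, C_1, one_mul, Finsupp.prod_fintype _ _ (fun _ => pow_zero _)]
  refine Finset.prod_congr rfl fun p _ => ?_
  rw [initialExp_apply]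
  split_ifs <;> simp

theorem prod_initial_single {R : Type*} [CommSemiring R] (i : Fin 3) (m : ℕ) :
    (∏ p : Fin 3 × Fin d, if (p.2 : ℕ) < (Pi.single i m : Fin 3 → ℕ) p.1 then X p else 1) =
      ∏ j : Fin d, if (j : ℕ) < m then (X (i, j) : MvPolynomial (Fin 3 × Fin d) R) else 1 := by
  rw [Fintype.prod_prod_type, Finset.prod_eq_single i]
  · simp
  · intro b _ hb
    simp [Pi.single_eq_of_ne hb]
  · simp

theorem prod_initial_vertex {R : Type*} [CommSemiring R] (i : Fin 3) :
    (∏ p : Fin 3 × Fin d, if (p.2 : ℕ) < (Pi.single i d : Fin 3 → ℕ) p.1 then X p else 1) =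
      ∏ j : Fin d, (X (i, j) : MvPolynomial (Fin 3 × Fin d) R) := by
  simp [prod_initial_single]

theorem vert8_eq_monomial (k : Type) [Field k] (i : Fin 3) :
    vert8 k d i = monomial (vertExp d i) 1 := by
  rw [vertExp, monomial_initialExp, prod_initial_vertex, vert8]

theorem defm8_eq_monomial (k : Type) [Field k] [NeZero d] (i : Fin 3) :
    defm8 k d i = monomial (defmExp d i) 1 := by
  have h : ∀ a b : Fin 3 × Fin d →₀ ℕ,
      (monomial (a + b) 1 : MvPolynomial _ (MvPolynomial (Fin 3) k)) =
        monomial a 1 * monomial b 1 := by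
    intro a b
    rw [monomial_mul, one_mul]
  rw [defmExp, h, h, monomial_initialExp, prod_initial_single, defm8]
  rfl

theorem vertExp_apply (i : Fin 3) (p : Fin 3 × Fin d) :
    vertExp d i p = if p.1 = i then 1 else 0 := by
  rw [vertExp, initialExp_apply, Pi.single_apply]
  by_cases h : p.1 = i <;> simp [h]

theorem NonVertexMultiple.mono {a b : Fin 3 × Fin d →₀ ℕ} (h : NonVertexMultiple a)
    (hab : a ≤ b) : NonVertexMultiple b := by
  obtain ⟨e, h1, h2, h3⟩ := h
  exact ⟨e, h1, h2, h3.trans hab⟩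

theorem nonVertexMultiple_of_vertExp_le (hd : 3 ≤ d) {a : Fin 3 × Fin d →₀ ℕ} {i j : Fin 3}
    (hij : i ≠ j) (hi : vertExp d i ≤ a) (hj : vertExp d j ≤ a) : NonVertexMultiple a := by
  refine ⟨Pi.single i (d - 1) + Pi.single j 1, ?_, ?_, ?_⟩
  · simp only [Pi.add_apply, Finset.sum_add_distrib, Finset.sum_pi_single', Finset.mem_univ,
      if_true]
    omega
  · intro l
    simp only [Pi.add_apply, Pi.single_apply]
    split_ifs <;> omega
  · intro p
    have h1 := hi p
    have h2 := hj p
    rw [vertExp_apply] at h1 h2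
    rw [initialExp_apply]
    simp only [Pi.add_apply, Pi.single_apply]
    split_ifs at * <;> omega

theorem nonVertexMultiple_add_defmExp [NeZero d] (hd : 3 ≤ d) {u : Fin 3 × Fin d →₀ ℕ}
    {i : Fin 3} (h : NonVertexMultiple (u + vertExp d i)) : NonVertexMultiple (u + defmExp d i) := by
  obtain ⟨e, h1, h2, h3⟩ := h
  obtain ⟨j, hji, hj⟩ : ∃ j, j ≠ i ∧ e j ≠ 0 := by
    by_contra! hc
    refine h2 i ?_
    rw [← h1, Finset.sum_eq_single i (fun b _ hb => hc b hb) (by simp)]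
  have hu : 1 ≤ u (j, 0) := by
    have := h3 (j, 0)
    rw [initialExp_apply, Finsupp.add_apply, vertExp_apply, if_neg hji] at this
    simpa [Nat.pos_of_ne_zero hj] using this
  have hone : ((1 : Fin d) : ℕ) = 1 := by
    rw [Fin.val_one', Nat.mod_eq_of_lt (by omega)]
  have hdj : 1 ≤ defmExp d i (j, 1) := by
    have : j = i + 1 ∨ j = i + 2 := by
      clear * - hji
      revert i j
      decide
    rcases this with rfl | rfl <;> simp [defmExp]
  refine ⟨Pi.single i (d - 2) + Pi.single j 2, ?_, ?_, ?_⟩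
  · simp only [Pi.add_apply, Finset.sum_add_distrib, Finset.sum_pi_single', Finset.mem_univ,
      if_true]
    omega
  · intro l
    simp only [Pi.add_apply, Pi.single_apply]
    split_ifs <;> omega
  · rintro ⟨l, m⟩
    rw [initialExp_apply, Finsupp.add_apply]
    by_cases hlj : l = j
    · subst hlj
      simp only [Pi.add_apply, Pi.single_apply, if_neg hji, if_true]
      split_ifs with hm
      · have : m = 0 ∨ m = 1 := by
          rw [Fin.ext_iff, Fin.ext_iff, hone, Fin.val_zero]
          omega
        rcases this with rfl | rfl <;> omega
      · exact Nat.zero_le _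
    · have hle : initialExp d (Pi.single i (d - 2)) (l, m) ≤ defmExp d i (l, m) := by
        rw [defmExp, Finsupp.add_apply]
        exact Nat.le_add_right _ _
      rw [initialExp_apply] at hle
      simp only [Pi.add_apply, Pi.single_eq_of_ne hlj, add_zero]
      exact hle.trans (Nat.le_add_left _ _)

/-- The total exponent of the variables `x_{1d}, x_{2d}, x_{3d}`. -/
def lastDegree (hd : 3 ≤ d) (a : Fin 3 × Fin d →₀ ℕ) : ℕ :=
  ∑ i : Fin 3, a (i, ⟨d - 1, by omega⟩)

theorem lastDegree_add (hd : 3 ≤ d) (a b : Fin 3 × Fin d →₀ ℕ) :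
    lastDegree hd (a + b) = lastDegree hd a + lastDegree hd b := by
  simp [lastDegree, Finset.sum_add_distrib]

theorem lastDegree_vertExp (hd : 3 ≤ d) (i : Fin 3) : lastDegree hd (vertExp d i) = 1 := by
  simp [lastDegree, vertExp_apply]

theorem lastDegree_defmExp [NeZero d] (hd : 3 ≤ d) (i : Fin 3) :
    lastDegree hd (defmExp d i) = 0 := by
  have hone : ((1 : Fin d) : ℕ) = 1 := by
    rw [Fin.val_one', Nat.mod_eq_of_lt (by omega)]
  have hne : (1 : Fin d) ≠ ⟨d - 1, by omega⟩ := by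
    rw [Ne, Fin.ext_iff, hone]
    simp only
    omega
  refine Finset.sum_eq_zero fun l _ => ?_
  have h1 : ∀ q : Fin 3, (q, (1 : Fin d)) ≠ (l, ⟨d - 1, by omega⟩) :=
    fun q h => hne (congrArg Prod.snd h)
  simp only [defmExp, Finsupp.add_apply, Finsupp.single_eq_of_ne' (h1 _), initialExp_apply,
    Pi.single_apply]
  split_ifs <;> omega

theorem lastDegree_reduce_lt [NeZero d] (hd : 3 ≤ d) {a : Fin 3 × Fin d →₀ ℕ} {i : Fin 3}
    (h : vertExp d i ≤ a) : lastDegree hd (a - vertExp d i + defmExp d i) < lastDegree hd a := by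
  conv_rhs => rw [← tsub_add_cancel_of_le h]
  rw [lastDegree_add, lastDegree_add, lastDegree_vertExp, lastDegree_defmExp]
  omega

open Classical in
/-- The normal form modulo `J` of the monomial with exponent vector `a`. -/
def normalForm (k : Type) [Field k] [NeZero d] (hd : 3 ≤ d) (a : Fin 3 × Fin d →₀ ℕ) :
    MvPolynomial (Fin 3 × Fin d) (MvPolynomial (Fin 3) k) :=
  if NonVertexMultiple a then 0
  else if h : ∃ i, vertExp d i ≤ a then
    -(X h.choose : MvPolynomial (Fin 3) k) •
      normalForm k hd (a - vertExp d h.choose + defmExp d h.choose)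
  else monomial a 1
termination_by lastDegree hd a
decreasing_by exact lastDegree_reduce_lt hd h.choose_spec

theorem normalForm_of_nonVertexMultiple (k : Type) [Field k] [NeZero d] (hd : 3 ≤ d)
    {a : Fin 3 × Fin d →₀ ℕ} (h : NonVertexMultiple a) : normalForm k hd a = 0 := by
  rw [normalForm, if_pos h]

theorem normalForm_add_vertExp (k : Type) [Field k] [NeZero d] (hd : 3 ≤ d)
    (u : Fin 3 × Fin d →₀ ℕ) (i : Fin 3) :
    normalForm k hd (u + vertExp d i) =
      -(X i : MvPolynomial (Fin 3) k) • normalForm k hd (u + defmExp d i) := by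
  by_cases h : NonVertexMultiple (u + vertExp d i)
  · rw [normalForm_of_nonVertexMultiple k hd h,
      normalForm_of_nonVertexMultiple k hd (nonVertexMultiple_add_defmExp hd h), smul_zero]
  · have hi : vertExp d i ≤ u + vertExp d i := le_add_self
    have hex : ∃ l, vertExp d l ≤ u + vertExp d i := ⟨i, hi⟩
    have hc : hex.choose = i := by
      by_contra hne
      exact h (nonVertexMultiple_of_vertExp_le hd hne hex.choose_spec hi)
    rw [normalForm, if_neg h, dif_pos hex, hc, add_tsub_cancel_right]

theorem monomial_mem_J8 (k : Type) [Field k] [NeZero d] {a : Fin 3 × Fin d →₀ ℕ}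
    (h : NonVertexMultiple a) : monomial a 1 ∈ J8 k d := by
  obtain ⟨e, h1, h2, h3⟩ := h
  rw [← tsub_add_cancel_of_le h3, ← one_mul (1 : MvPolynomial (Fin 3) k), ← monomial_mul]
  exact Ideal.mul_mem_left _ _
    (Ideal.subset_span (Or.inl ⟨e, h1, h2, monomial_initialExp e⟩))

theorem monomial_sub_normalForm_mem (k : Type) [Field k] [NeZero d] (hd : 3 ≤ d)
    (a : Fin 3 × Fin d →₀ ℕ) : monomial a 1 - normalForm k hd a ∈ J8 k d := by
  induction hn : lastDegree hd a using Nat.strong_induction_on generalizing a with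
  | _ n ih =>
    by_cases h : NonVertexMultiple a
    · rw [normalForm_of_nonVertexMultiple k hd h, sub_zero]
      exact monomial_mem_J8 k h
    by_cases hex : ∃ i, vertExp d i ≤ a
    · obtain ⟨i, hi⟩ := hex
      obtain ⟨u, rfl⟩ : ∃ u, a = u + vertExp d i := ⟨_, (tsub_add_cancel_of_le hi).symm⟩
      have hlt := lastDegree_reduce_lt hd hi
      rw [add_tsub_cancel_right, hn] at hlt
      have hu := ih _ hlt _ rfl
      have hF : vert8 k d i + C (X i) * defm8 k d i ∈ J8 k d :=
        Ideal.subset_span (Or.inr ⟨i, rfl⟩)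
      rw [normalForm_add_vertExp]
      have key : (monomial (u + vertExp d i) 1 :
          MvPolynomial (Fin 3 × Fin d) (MvPolynomial (Fin 3) k)) -
            -(X i : MvPolynomial (Fin 3) k) • normalForm k hd (u + defmExp d i) =
          monomial u 1 * (vert8 k d i + C (X i) * defm8 k d i) -
            C (X i) * (monomial (u + defmExp d i) 1 - normalForm k hd (u + defmExp d i)) := by
        have hm : ∀ b : Fin 3 × Fin d →₀ ℕ,
            (monomial (u + b) 1 : MvPolynomial _ (MvPolynomial (Fin 3) k)) =
              monomial u 1 * monomial b 1 := by
          intro b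
          rw [monomial_mul, one_mul]
        rw [vert8_eq_monomial, defm8_eq_monomial, smul_eq_C_mul, hm, hm, map_neg]
        ring
      rw [key]
      exact sub_mem (Ideal.mul_mem_left _ _ hF) (Ideal.mul_mem_left _ _ hu)
    · rw [normalForm, if_neg h, dif_neg hex, sub_self]
      exact zero_mem _

/-- The `R`-linear map taking a polynomial to its normal form modulo `J`. -/
def normalFormMap (k : Type) [Field k] [NeZero d] (hd : 3 ≤ d) :
    MvPolynomial (Fin 3 × Fin d) (MvPolynomial (Fin 3) k) →ₗ[MvPolynomial (Fin 3) k]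
      MvPolynomial (Fin 3 × Fin d) (MvPolynomial (Fin 3) k) :=
  (basisMonomials (Fin 3 × Fin d) (MvPolynomial (Fin 3) k)).constr (MvPolynomial (Fin 3) k)
    (normalForm k hd)

theorem normalFormMap_monomial (k : Type) [Field k] [NeZero d] (hd : 3 ≤ d)
    (a : Fin 3 × Fin d →₀ ℕ) (r : MvPolynomial (Fin 3) k) :
    normalFormMap k hd (monomial a r) = r • normalForm k hd a := by
  have h := (basisMonomials (Fin 3 × Fin d) (MvPolynomial (Fin 3) k)).constr_basis
    (MvPolynomial (Fin 3) k) (normalForm k hd) a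
  rw [coe_basisMonomials] at h
  rw [← mul_one r, ← smul_eq_mul, ← smul_monomial, map_smul, smul_eq_mul, mul_one]
  exact congrArg (r • ·) h

theorem sub_normalFormMap_mem (k : Type) [Field k] [NeZero d] (hd : 3 ≤ d)
    (p : MvPolynomial (Fin 3 × Fin d) (MvPolynomial (Fin 3) k)) :
    p - normalFormMap k hd p ∈ J8 k d := by
  induction p using MvPolynomial.induction_on' with
  | monomial a r =>
    have h : monomial a r - normalFormMap k hd (monomial a r) =
        C r * (monomial a 1 - normalForm k hd a) := by
      rw [normalFormMap_monomial, smul_eq_C_mul, mul_sub, C_mul_monomial, mul_one]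
    rw [h]
    exact Ideal.mul_mem_left _ _ (monomial_sub_normalForm_mem k hd a)
  | add p q hp hq =>
    rw [map_add, add_sub_add_comm]
    exact add_mem hp hq

theorem normalFormMap_eq_zero_of_mem (k : Type) [Field k] [NeZero d] (hd : 3 ≤ d)
    {p : MvPolynomial (Fin 3 × Fin d) (MvPolynomial (Fin 3) k)} (hp : p ∈ J8 k d) :
    normalFormMap k hd p = 0 := by
  suffices h : ∀ q, normalFormMap k hd (q * p) = 0 by simpa using h 1
  refine Submodule.span_induction (p := fun p _ => ∀ q, normalFormMap k hd (q * p) = 0)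
    ?_ ?_ ?_ ?_ hp
  · intro g hg q
    induction q using MvPolynomial.induction_on' with
    | add p q hp hq => rw [add_mul, map_add, hp, hq, add_zero]
    | monomial u r =>
      rcases hg with ⟨e, h1, h2, rfl⟩ | ⟨i, rfl⟩
      · rw [← monomial_initialExp, monomial_mul, normalFormMap_monomial,
          normalForm_of_nonVertexMultiple k hd ⟨e, h1, h2, le_add_self⟩, smul_zero]
      · rw [vert8_eq_monomial, defm8_eq_monomial, mul_add, C_mul_monomial, monomial_mul,
          monomial_mul, map_add, normalFormMap_monomial, normalFormMap_monomial,
          normalForm_add_vertExp, smul_smul, ← add_smul]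
        simp
  · simp
  · intro x y _ _ hx hy q
    rw [mul_add, map_add, hx, hy, add_zero]
  · intro a x _ hx q
    rw [smul_eq_mul, ← mul_assoc, hx]

theorem flat_quotient_J8 (k : Type) [Field k] [NeZero d] (hd : 3 ≤ d) :
    Module.Flat (MvPolynomial (Fin 3) k)
      (MvPolynomial (Fin 3 × Fin d) (MvPolynomial (Fin 3) k) ⧸ J8 k d) := by
  let R := MvPolynomial (Fin 3) k
  let e := Submodule.Quotient.restrictScalarsEquiv R (J8 k d)
  let N := ((J8 k d).restrictScalars R).liftQ (normalFormMap k hd)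
    fun p hp => normalFormMap_eq_zero_of_mem k hd hp
  refine Module.Flat.of_retract (N ∘ₗ e.symm.toLinearMap)
    (e.toLinearMap ∘ₗ ((J8 k d).restrictScalars R).mkQ) ?_
  refine LinearMap.ext fun x => ?_
  obtain ⟨p, rfl⟩ := Submodule.Quotient.mk_surjective _ x
  exact ((Submodule.Quotient.eq _).2 (sub_normalFormMap_mem k hd p)).symm

end NormalForm

theorem red8_prod_initial (k : Type) [Field k] (d : ℕ) (e : Fin 3 → ℕ) :
    red8 k d (∏ p : Fin 3 × Fin d, if (p.2 : ℕ) < e p.1 then X p else 1) =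
      ∏ p : Fin 3 × Fin d, if (p.2 : ℕ) < e p.1 then X p else 1 := by
  rw [map_prod]
  refine Finset.prod_congr rfl fun p _ => ?_
  split_ifs <;> simp [red8]

theorem red8_deformed_vertex (k : Type) [Field k] (d : ℕ) [NeZero d] (i : Fin 3) :
    red8 k d (vert8 k d i + C (X i) * defm8 k d i) =
      ∏ p : Fin 3 × Fin d,
        if (p.2 : ℕ) < (Pi.single i d : Fin 3 → ℕ) p.1 then X p else 1 := by
  have h : red8 k d (C (X i)) = 0 := by simp [red8]
  rw [map_add, map_mul, h, zero_mul, add_zero, vert8, ← prod_initial_vertex, red8_prod_initial]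

theorem map_red8_J8 (k : Type) [Field k] (d : ℕ) [NeZero d] :
    Ideal.map (red8 k d) (J8 k d) = StdIdeal k 3 d := by
  rw [J8, Ideal.map_span, StdIdeal]
  congr 1
  ext f
  constructor
  · rintro ⟨g, ⟨e, h1, -, rfl⟩ | ⟨i, rfl⟩, rfl⟩
    · exact ⟨e, h1, red8_prod_initial k d e⟩
    · exact ⟨Pi.single i d, by simp, red8_deformed_vertex k d i⟩
  · rintro ⟨e, h1, rfl⟩
    by_cases h : ∃ i, e i = d
    · obtain ⟨i, hi⟩ := h
      have he : e = Pi.single i d := by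
        have hsum := Finset.add_sum_erase Finset.univ e (Finset.mem_univ i)
        have h0 : ∑ j ∈ Finset.univ.erase i, e j = 0 := by omega
        funext j
        by_cases hj : j = i
        · subst hj
          simpa using hi
        · rw [Pi.single_eq_of_ne hj]
          exact Finset.sum_eq_zero_iff.1 h0 j (by simp [hj])
      rw [he]
      exact ⟨_, Or.inr ⟨i, rfl⟩, red8_deformed_vertex k d i⟩
    · push Not at h
      exact ⟨_, Or.inl ⟨e, h1, h, rfl⟩, red8_prod_initial k d e⟩

theorem statement8 (k : Type) [Field k] (d : ℕ) [NeZero d] (hd : 3 ≤ d) :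
    Module.Flat (MvPolynomial (Fin 3) k)
      (MvPolynomial (Fin 3 × Fin d) (MvPolynomial (Fin 3) k) ⧸ J8 k d) ∧
    Ideal.map (red8 k d) (J8 k d) = StdIdeal k 3 d :=
  ⟨flat_quotient_J8 k hd, map_red8_J8 k d⟩

end
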